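/- For every integer k ≥ 4, there does not exist a connected chordal total k-uniform graph. -/

import Mathlib

open SimpleGraph

/-- `A ⊆ V(G)` is a total dominating set of `G`: every vertex has a neighbor in `A`. -/
def TotalDomSet {V : Type*} (G : SimpleGraph V) (A : Set V) : Prop :=
  ∀ v : V, ∃ a ∈ A, G.Adj v a

/-- `s` is a legal (open neighborhood) sequence of `G`: the vertices are distinct and every
vertex after the first has a neighbor adjacent to no vertex preceding it in the sequence. -/
def LegalSeq {V : Type*} (G : SimpleGraph V) (s : List V) : Prop :=
  s.Nodup ∧ ∀ (i : ℕ) (h : i < s.length), 0 < i →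
    ∃ w : V, G.Adj (s.get ⟨i, h⟩) w ∧ ∀ u ∈ s.take i, ¬ G.Adj u w

/-- `s` is a total dominating sequence of `G`: a legal sequence whose underlying set is a
total dominating set. -/
def TotalDomSeq {V : Type*} (G : SimpleGraph V) (s : List V) : Prop :=
  LegalSeq G s ∧ TotalDomSet G {v | v ∈ s}

/-- The total domination number `γ_t(G)`: the minimum size of a total dominating set. -/
noncomputable def totalDomNum {V : Type*} (G : SimpleGraph V) : ℕ :=
  sInf {n | ∃ A : Set V, TotalDomSet G A ∧ A.ncard = n}

/-- The Grundy total domination number `γ_gr^t(G)`: the maximum length of a total dominating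
sequence. -/
noncomputable def grundyTotalDomNum {V : Type*} (G : SimpleGraph V) : ℕ :=
  sSup {n | ∃ s : List V, TotalDomSeq G s ∧ s.length = n}

/-- `G` is total `k`-uniform if `γ_t(G) = γ_gr^t(G) = k`. -/
def TotalKUniform {V : Type*} (G : SimpleGraph V) (k : ℕ) : Prop :=
  totalDomNum G = k ∧ grundyTotalDomNum G = k

/-- `G` has no isolated vertices. -/
def NoIsolatedVerts {V : Type*} (G : SimpleGraph V) : Prop :=
  ∀ v : V, ∃ w : V, G.Adj v w

/-- The closed neighborhood `N[v] = N(v) ∪ {v}`. -/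
def closedNbhd {V : Type*} (G : SimpleGraph V) (v : V) : Set V :=
  insert v (G.neighborSet v)

/-- `G` is false twin-free: no two distinct vertices have the same (open) neighborhood. -/
def FalseTwinFree {V : Type*} (G : SimpleGraph V) : Prop :=
  ∀ u v : V, u ≠ v → G.neighborSet u ≠ G.neighborSet v

/-- `G` is chordal: it contains no induced cycle of length greater than 3. -/
def IsChordal {V : Type*} (G : SimpleGraph V) : Prop :=
  ∀ (n : ℕ), 4 ≤ n → ∀ S : Set V, ¬ Nonempty (G.induce S ≃g SimpleGraph.cycleGraph n)

/-- A legal sequence can be extended by any vertex with a neighbor that is not yet dominated. -/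
theorem LegalSeq.append_singleton {V : Type*} {G : SimpleGraph V} {l : List V}
    (hl : LegalSeq G l) {v w : V} (hvw : G.Adj v w) (hw : ∀ u ∈ l, ¬ G.Adj u w) :
    LegalSeq G (l ++ [v]) := by
  refine ⟨?_, fun i hi h0 => ?_⟩
  · have hv : v ∉ l := fun hv => hw v hv hvw
    rw [List.nodup_append]
    refine ⟨hl.1, List.nodup_singleton v, fun a ha b hb => ?_⟩
    rw [List.mem_singleton] at hb
    rintro rfl
    exact hv (hb ▸ ha)
  · rcases lt_or_ge i l.length with h | h
    · obtain ⟨x, hx, hx'⟩ := hl.2 i h h0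
      refine ⟨x, ?_, ?_⟩
      · simpa [List.getElem_append_left h] using hx
      · rwa [List.take_append_of_le_length h.le]
    · have hi' : i = l.length := by
        simp only [List.length_append, List.length_singleton] at hi
        omega
      subst hi'
      exact ⟨w, by simpa using hvw, by simpa using hw⟩

/-- In a finite graph without isolated vertices, every legal sequence extends to a total
dominating sequence. -/
theorem LegalSeq.exists_totalDomSeq {V : Type*} [Finite V] {G : SimpleGraph V}
    (hiso : NoIsolatedVerts G) (l : List V) (hl : LegalSeq G l) :
    ∃ t : List V, TotalDomSeq G (l ++ t) := by
  have := Fintype.ofFinite V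
  induction hn : Fintype.card V - l.length using Nat.strong_induction_on generalizing l with
  | _ n ih =>
    by_cases hdom : TotalDomSet G {v | v ∈ l}
    · exact ⟨[], by simpa using ⟨hl, hdom⟩⟩
    · simp only [TotalDomSet, Set.mem_ofPred_eq, not_forall, not_exists, not_and] at hdom
      obtain ⟨w, hw⟩ := hdom
      obtain ⟨v, hv⟩ := hiso w
      have hl' := hl.append_singleton hv.symm fun u hu h => hw u hu h.symm
      have hcard := hl'.1.length_le_card
      simp only [List.length_append, List.length_singleton] at hcard
      obtain ⟨t, ht⟩ := ih _ (by simp; omega) (l ++ [v]) hl' rfl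
      exact ⟨[v] ++ t, by simpa using ht⟩

theorem TotalDomSeq.totalDomNum_le {V : Type*} {G : SimpleGraph V} {l : List V}
    (hl : TotalDomSeq G l) : totalDomNum G ≤ l.length := by
  classical
  have h : totalDomNum G ≤ {v | v ∈ l}.ncard := Nat.sInf_le ⟨_, hl.2, rfl⟩
  refine h.trans ?_
  rw [← List.coe_toFinset, Set.ncard_coe_finset]
  exact l.toFinset_card_le

theorem TotalDomSeq.le_grundyTotalDomNum {V : Type*} [Finite V] {G : SimpleGraph V}
    {l : List V} (hl : TotalDomSeq G l) : l.length ≤ grundyTotalDomNum G := by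
  have := Fintype.ofFinite V
  refine le_csSup ⟨Fintype.card V, ?_⟩ ⟨l, hl, rfl⟩
  rintro n ⟨s, hs, rfl⟩
  exact hs.1.1.length_le_card

/-- In a total `k`-uniform graph, if `N(r) ⊆ N[s]` for an edge `sr`, then `N(y) ⊆ N[s]` for
every neighbor `y` of `s`. -/
theorem TotalKUniform.neighborSet_subset {V : Type*} [Finite V] {G : SimpleGraph V} {k : ℕ}
    (hk : TotalKUniform G k) (hiso : NoIsolatedVerts G) {s r y : V} (hsr : G.Adj s r)
    (hr : G.neighborSet r ⊆ closedNbhd G s) (hsy : G.Adj s y) :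
    G.neighborSet y ⊆ closedNbhd G s := by
  intro z hyz
  by_contra hz
  have hrz : ¬ G.Adj r z := fun h => hz (hr h)
  have hsz : ¬ G.Adj s z := fun h => hz (Or.inr h)
  have hr' : ∀ w, G.Adj r w → G.Adj s w ∨ G.Adj y w := fun w hw => by
    rcases hr hw with rfl | h
    · exact Or.inr hsy.symm
    · exact Or.inl h
  have hs1 : LegalSeq G [s] :=
    ⟨List.nodup_singleton s, fun i hi h0 => by simp at hi; omega⟩
  have hs2 : LegalSeq G ([s] ++ [y]) :=
    hs1.append_singleton hyz (by simpa using hsz)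
  obtain ⟨t, ht⟩ := hs2.exists_totalDomSeq hiso
  simp only [List.cons_append, List.nil_append] at ht
  have hrt : r ∉ t := fun hrt => by
    obtain ⟨i, hi, rfl⟩ := List.getElem_of_mem hrt
    obtain ⟨w, hw, hw'⟩ := ht.1.2 (i + 2) (by simpa using hi) (by omega)
    have h1 := hw' s (by simp)
    have h2 := hw' y (by simp)
    exact (hr' w (by simpa using hw)).elim h1 h2
  have hry : r ≠ y := by
    rintro rfl
    exact hrz hyz
  have hlong : TotalDomSeq G (s :: r :: y :: t) := by
    refine ⟨⟨?_, fun i hi h0 => ?_⟩, fun v => ?_⟩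
    · have hnd := ht.1.1
      have hne := hsr.ne
      simp only [List.nodup_cons, List.mem_cons, not_or] at hnd ⊢
      tauto
    · match i, hi, h0 with
      | 1, _, _ => exact ⟨s, by simpa using hsr.symm, by simp⟩
      | 2, _, _ => exact ⟨z, by simpa using hyz, by simpa using ⟨hsz, hrz⟩⟩
      | i + 3, hi, _ =>
        obtain ⟨w, hw, hw'⟩ := ht.1.2 (i + 2) (by simpa using hi) (by omega)
        refine ⟨w, by simpa using hw, fun u hu => ?_⟩
        simp only [List.take_succ_cons, List.mem_cons] at hu hw'
        rcases hu with rfl | rfl | hu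
        · exact hw' u (by simp)
        · intro h
          exact (hr' w h).elim (hw' s (by simp)) (hw' y (by simp))
        · exact hw' u (Or.inr hu)
    · obtain ⟨a, ha, hva⟩ := ht.2 v
      refine ⟨a, ?_, hva⟩
      simp only [Set.mem_ofPred_eq, List.mem_cons] at ha ⊢
      tauto
  have h1 := ht.totalDomNum_le
  have h2 := hlong.le_grundyTotalDomNum
  rw [hk.1] at h1
  rw [hk.2] at h2
  simp only [List.length_cons] at h1 h2
  omega

/-- An induced path `f 0, …, f (n - 1)` with `n` vertices, closed up by an edge between its
ends, is an induced cycle. -/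
theorem nonempty_induce_iso_cycleGraph {V : Type*} {G : SimpleGraph V} {n : ℕ}
    (f : ℕ → V) (hf : ∀ a b, a < b → b < n →
      f a ≠ f b ∧ (G.Adj (f a) (f b) ↔ b = a + 1 ∨ (a = 0 ∧ b + 1 = n))) :
    Nonempty (G.induce (Set.range fun a : Fin n => f a) ≃g SimpleGraph.cycleGraph n) := by
  have hinj : Function.Injective fun a : Fin n => f a := by
    intro a b hab
    rcases lt_trichotomy a b with h | h | h
    · exact absurd hab (hf a b h b.2).1
    · exact h
    · exact absurd hab.symm (hf b a h a.2).1
  have key : ∀ a b : Fin n, a < b →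
      (G.Adj (f a) (f b) ↔ (SimpleGraph.cycleGraph n).Adj a b) := by
    intro a b hab
    rw [(hf a b hab b.2).2, SimpleGraph.cycleGraph_adj', Fin.sub_val_of_le hab.le,
      Fin.coe_sub_iff_lt.2 hab]
    have := a.2
    have := b.2
    have : a.val < b.val := hab
    omega
  refine ⟨(RelIso.symm ⟨Equiv.ofInjective _ hinj, fun {a b} => ?_⟩)⟩
  change G.Adj (f a) (f b) ↔ _
  rcases lt_trichotomy a b with h | rfl | h
  · exact key a b h
  · simp
  · rw [G.adj_comm, key b a h, SimpleGraph.adj_comm]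

/-- A finite chordal graph with at least one edge has an edge `sr` with `N(r) ⊆ N[s]`. -/
theorem IsChordal.exists_adj_neighborSet_subset {V : Type*} [Finite V] {G : SimpleGraph V}
    (hch : IsChordal G) {a b : V} (hab : G.Adj a b) :
    ∃ s r, G.Adj s r ∧ G.neighborSet r ⊆ closedNbhd G s := by
  by_contra! hcon
  have hnext : ∀ p : {p : V × V // G.Adj p.1 p.2}, ∃ q : {p : V × V // G.Adj p.1 p.2},
      q.1.1 = p.1.2 ∧ q.1.2 ≠ p.1.1 ∧ ¬ G.Adj p.1.1 q.1.2 := by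
    rintro ⟨⟨s, r⟩, h⟩
    obtain ⟨z, hz, hz'⟩ := Set.not_subset.1 (hcon s r h)
    exact ⟨⟨(r, z), hz⟩, rfl, fun h => hz' (Or.inl h), fun h => hz' (Or.inr h)⟩
  choose next hnext1 hnext2 hnext3 using hnext
  let p : ℕ → {p : V × V // G.Adj p.1 p.2} := fun n => next^[n] ⟨(a, b), hab⟩
  have hp : ∀ n, p (n + 1) = next (p n) := fun n => Function.iterate_succ_apply' ..
  obtain ⟨v, hv⟩ : ∃ v : ℕ → V, ∀ n, v n = (p n).1.1 := ⟨_, fun _ => rfl⟩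
  have hv1 : ∀ n, v (n + 1) = (p n).1.2 := fun n => by rw [hv, hp, hnext1]
  have hadj : ∀ n, G.Adj (v n) (v (n + 1)) := fun n => by
    rw [hv1, hv]
    exact (p n).2
  have hne2 : ∀ n, v (n + 2) ≠ v n := fun n => by
    rw [hv1 (n + 1), hv, hp]
    exact hnext2 _
  have hnadj2 : ∀ n, ¬ G.Adj (v n) (v (n + 2)) := fun n => by
    rw [hv1 (n + 1), hv, hp]
    exact hnext3 _
  have hback : ∀ i j, i < j → v i = v j → i + 1 + 2 ≤ j ∧ G.Adj (v (i + 1)) (v j) := by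
    intro i j hij h
    refine ⟨?_, h ▸ (hadj i).symm⟩
    by_contra hlt
    obtain rfl | rfl : j = i + 1 ∨ j = i + 2 := by omega
    · exact (hadj i).ne h
    · exact hne2 i h.symm
  have hex : ∃ j, ∃ i, i + 2 ≤ j ∧ G.Adj (v i) (v j) := by
    obtain ⟨i, j, hij, h⟩ := Finite.exists_ne_map_eq_of_infinite v
    rcases hij.lt_or_gt with hlt | hlt
    · exact ⟨j, i + 1, hback i j hlt h⟩
    · exact ⟨i, j + 1, hback j i hlt h.symm⟩
  classical
  obtain ⟨j, ⟨i₀, hi₀⟩, hmin⟩ : ∃ j, (∃ i, i + 2 ≤ j ∧ G.Adj (v i) (v j)) ∧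
      ∀ m < j, ¬ ∃ i, i + 2 ≤ m ∧ G.Adj (v i) (v m) :=
    ⟨Nat.find hex, Nat.find_spec hex, fun m hm => Nat.find_min hex hm⟩
  have hmax := Nat.findGreatest_spec (P := fun i => i + 2 ≤ j ∧ G.Adj (v i) (v j))
    (n := j) (by omega) hi₀
  have hgt : ∀ m, Nat.findGreatest (fun i => i + 2 ≤ j ∧ G.Adj (v i) (v j)) j < m →
      m + 2 ≤ j → ¬ G.Adj (v m) (v j) := fun m h1 h2 h3 =>
    Nat.findGreatest_is_greatest h1 (by omega) ⟨h2, h3⟩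
  generalize Nat.findGreatest (fun i => i + 2 ≤ j ∧ G.Adj (v i) (v j)) j = i at hmax hgt
  have hij : i + 3 ≤ j := by
    by_contra hlt
    obtain rfl : j = i + 2 := by omega
    exact hnadj2 i hmax.2
  refine hch (j - i + 1) (by omega) _
    (nonempty_induce_iso_cycleGraph (fun m => v (i + m)) fun m l hml hl => ?_)
  refine ⟨fun h => ?_, fun h => ?_, ?_⟩
  · obtain ⟨h1, h2⟩ := hback _ _ (by omega) h
    rcases Nat.lt_or_ge (i + l) j with hlt | hge
    · exact hmin _ hlt ⟨_, h1, h2⟩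
    · obtain rfl : j = i + l := by omega
      exact hgt _ (by omega) h1 h2
  · by_contra! hcon'
    rcases Nat.lt_or_ge (i + l) j with hlt | hge
    · exact hmin _ hlt ⟨i + m, by omega, h⟩
    · obtain rfl : j = i + l := by omega
      have : m ≠ 0 := fun h0 => hcon'.2 h0 (by omega)
      exact hgt (i + m) (by omega) (by omega) h
  · rintro (rfl | ⟨rfl, h⟩)
    · exact hadj (i + m)
    · obtain rfl : j = i + l := by omega
      exact hmax.2

/-- For every `k ≥ 4`, there is no connected chordal total `k`-uniform graph. -/
theorem stmt_17 {V : Type*} [Finite V] (G : SimpleGraph V) (k : ℕ) (hk : 4 ≤ k)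
    (hiso : NoIsolatedVerts G) (hconn : G.Connected) (hch : IsChordal G) :
    ¬ TotalKUniform G k := by
  intro hu
  obtain ⟨a⟩ := hconn.nonempty
  obtain ⟨b, hab⟩ := hiso a
  obtain ⟨s, r, hsr, hr⟩ := hch.exists_adj_neighborSet_subset hab
  have huniv : ∀ v, v ∈ closedNbhd G s := fun v => by
    have hreach := (SimpleGraph.reachable_iff_reflTransGen s v).1 (hconn.preconnected s v)
    induction hreach with
    | refl => exact Or.inl rfl
    | tail _ hbc ih =>
      rcases ih with rfl | h
      · exact Or.inr hbc
      · exact hu.neighborSet_subset hiso hsr hr h hbc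
  have hdom : TotalDomSet G {s, r} := fun v => by
    rcases huniv v with rfl | h
    · exact ⟨r, by simp, hsr⟩
    · exact ⟨s, by simp, h.symm⟩
  have h1 : totalDomNum G ≤ ({s, r} : Set V).ncard := Nat.sInf_le ⟨_, hdom, rfl⟩
  have h2 := Set.ncard_pair hsr.ne
  have h3 := hu.1
  omega
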